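/- If W: M^{3×3} → [0,∞) satisfies the frame indifference condition W(RF) = W(F) for all R ∈ SO(3) and F with det F > 0, W is twice differentiable at the identity with W(Id) = 0 and DW(Id) = 0, then the Hessian C = D²W(Id) satisfies C F = C (sym F) for every 3×3 matrix F. -/

import Mathlib

open Matrix

attribute [local instance]
  Matrix.frobeniusNormedAddCommGroup Matrix.frobeniusNormedSpace

/-- Symmetric part of a matrix. -/
noncomputable def symPart (A : Matrix (Fin 3) (Fin 3) ℝ) : Matrix (Fin 3) (Fin 3) ℝ :=
  (1/2 : ℝ) • (A + Aᵀ)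

section SkewExponential

attribute [local instance] Matrix.frobeniusNormedRing Matrix.frobeniusNormedAlgebra

variable {n : Type*} [Fintype n] [DecidableEq n]

/-- The exponential of a skew-symmetric real matrix is orthogonal. -/
theorem Matrix.transpose_exp_mul_exp_of_skew {A : Matrix n n ℝ} (hA : Aᵀ = -A) :
    (NormedSpace.exp A)ᵀ * NormedSpace.exp A = 1 := by
  rw [← Matrix.exp_transpose, hA, ← Matrix.exp_add_of_commute _ _ (Commute.refl A).neg_left,
    neg_add_cancel, NormedSpace.exp_zero]

/-- The exponential of a skew-symmetric real matrix has determinant one, being the square of an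
orthogonal matrix. -/
theorem Matrix.det_exp_of_skew {A : Matrix n n ℝ} (hA : Aᵀ = -A) :
    (NormedSpace.exp A).det = 1 := by
  set B : Matrix n n ℝ := (1 / 2 : ℝ) • A with hB
  have hBskew : Bᵀ = -B := by rw [hB, Matrix.transpose_smul, hA, smul_neg]
  have hAB : A = B + B := by rw [hB, ← add_smul]; norm_num
  have hdet := congrArg Matrix.det (Matrix.transpose_exp_mul_exp_of_skew hBskew)
  rw [Matrix.det_mul, Matrix.det_transpose, Matrix.det_one] at hdet
  rw [hAB, Matrix.exp_add_of_commute _ _ rfl, Matrix.det_mul, hdet]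

theorem Matrix.hasDerivAt_exp_smul_zero (A : Matrix n n ℝ) :
    HasDerivAt (fun t : ℝ => NormedSpace.exp (t • A)) A 0 := by
  have h := hasDerivAt_exp_smul_const A (0 : ℝ)
  rw [zero_smul, NormedSpace.exp_zero, one_mul] at h
  exact h

end SkewExponential

/-- The second derivative of a nonnegative function annihilates the velocity of any curve along
which the function vanishes, since the first derivative is zero on that curve. -/
theorem fderiv_fderiv_eq_zero_of_curve {E : Type*} [NormedAddCommGroup E] [NormedSpace ℝ E]
    {W : E → ℝ} (hnonneg : ∀ y, 0 ≤ W y) {x v : E} (hdiff : DifferentiableAt ℝ (fderiv ℝ W) x)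
    {c : ℝ → E} (hc : HasDerivAt c v 0) (hc0 : c 0 = x) (hW : ∀ t, W (c t) = 0) :
    fderiv ℝ (fderiv ℝ W) x v = 0 := by
  have hzero : ∀ t, fderiv ℝ W (c t) = 0 := fun t =>
    IsLocalMin.fderiv_eq_zero (Filter.Eventually.of_forall fun y => (hW t).trans_le (hnonneg y))
  have hcomp := hdiff.hasFDerivAt.comp_hasDerivAt_of_eq (0 : ℝ) hc hc0.symm
  exact hcomp.unique ((hasDerivAt_const (0 : ℝ) (0 : E →L[ℝ] ℝ)).congr_of_eventuallyEq
    (Filter.Eventually.of_forall hzero))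

/-- The Hessian at the identity of a nonnegative function that vanishes on all rotations
annihilates skew-symmetric matrices. -/
theorem fderiv_fderiv_one_of_skew {n : Type*} [Fintype n] [DecidableEq n]
    {W : Matrix n n ℝ → ℝ} (hnonneg : ∀ F, 0 ≤ W F)
    (hrot : ∀ R : Matrix n n ℝ, Rᵀ * R = 1 → R.det = 1 → W R = 0)
    (hdiff : DifferentiableAt ℝ (fderiv ℝ W) 1) {A : Matrix n n ℝ} (hA : Aᵀ = -A) :
    fderiv ℝ (fderiv ℝ W) 1 A = 0 := by
  refine fderiv_fderiv_eq_zero_of_curve hnonneg hdiff (Matrix.hasDerivAt_exp_smul_zero A)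
    (by rw [zero_smul, NormedSpace.exp_zero]) fun t => ?_
  have htA : (t • A)ᵀ = -(t • A) := by rw [Matrix.transpose_smul, hA, smul_neg]
  exact hrot _ (Matrix.transpose_exp_mul_exp_of_skew htA) (Matrix.det_exp_of_skew htA)

/-- if `W` is frame indifferent (`W(RF) = W(F)` for all rotations `R` and all
`F` with positive determinant), twice differentiable at the identity, with `W(Id) = 0` and
`DW(Id) = 0`, then the Hessian `C = D²W(Id)` satisfies `C F = C (sym F)` for every `F`. -/
theorem stmt1
    (W : Matrix (Fin 3) (Fin 3) ℝ → ℝ)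
    (hWnonneg : ∀ F, 0 ≤ W F)
    (hframe : ∀ R F : Matrix (Fin 3) (Fin 3) ℝ,
      Rᵀ * R = 1 → R.det = 1 → 0 < F.det → W (R * F) = W F)
    (hdiff : ContDiffAt ℝ 2 W 1)
    (hW0 : W 1 = 0)
    (hDW : fderiv ℝ W 1 = 0) :
    ∀ F : Matrix (Fin 3) (Fin 3) ℝ,
      fderiv ℝ (fderiv ℝ W) 1 F = fderiv ℝ (fderiv ℝ W) 1 (symPart F) := by
  intro F
  have hskew : (F - symPart F)ᵀ = -(F - symPart F) := by
    ext i j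
    simp only [symPart, Matrix.transpose_apply, Matrix.sub_apply, Matrix.neg_apply,
      Matrix.smul_apply, Matrix.add_apply, smul_eq_mul]
    ring
  have hrot : ∀ R : Matrix (Fin 3) (Fin 3) ℝ, Rᵀ * R = 1 → R.det = 1 → W R = 0 :=
    fun R hR hdet => by simpa [hW0] using hframe R 1 hR hdet (by simp)
  have hD : DifferentiableAt ℝ (fderiv ℝ W) 1 :=
    (hdiff.fderiv_right (m := 1) (by norm_num)).differentiableAt (by norm_num)
  rw [← sub_eq_zero, ← map_sub]
  exact fderiv_fderiv_one_of_skew hWnonneg hrot hD hskew
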